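/- Let n ≥ 1, 0 ≤ k ≤ n, and r ≥ 1. The pullback map Φ^* restricts to a linear isomorphism from P̊_rΛ^k(T^n) onto u_N P_{2r+k-n-1}Λ^k_o(S^n), the space of forms u_N β with β an odd form in P_{2r+k-n-1}Λ^k(S^n). -/

import Mathlib

open scoped BigOperators
open MeasureTheory

noncomputable section

/-- Vectors in `ℝ^m`. -/
abbrev Vec (m : ℕ) := Fin m → ℝ

/-- Differential `k`-forms on `ℝ^m`, given pointwise as alternating `k`-tensors. -/
abbrev Form (m k : ℕ) := Vec m → (Vec m [⋀^Fin k]→ₗ[ℝ] ℝ)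

/-- A multivariate polynomial has (total) degree at most `r : ℤ`. -/
def degLE {m : ℕ} (r : ℤ) (p : MvPolynomial (Fin m) ℝ) : Prop :=
  ∀ d ∈ p.support, ((d.sum fun _ e => e : ℕ) : ℤ) ≤ r

/-- `P_rΛ^k(ℝ^m)`: differential `k`-forms with polynomial coefficients of degree at most `r`. -/
def PL (m k : ℕ) (r : ℤ) : Set (Form m k) :=
  {α | ∀ v : Fin k → Vec m, ∃ p : MvPolynomial (Fin m) ℝ,
      degLE r p ∧ ∀ x, α x v = MvPolynomial.eval x p}

/-- Interior product with the radial vector field `X = Σ xᵢ ∂/∂xᵢ`. -/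
def iU {m k : ℕ} (β : Form m (k + 1)) : Form m k := fun x => (β x).curryLeft x

/-- `P_r⁻Λ^k(ℝ^m) := i_X P_{r-1}Λ^{k+1}(ℝ^m)`. -/
def PLm (m k : ℕ) (r : ℤ) : Set (Form m k) := iU '' PL m (k + 1) (r - 1)

/-- The reflection negating the `i`-th coordinate, as a map. -/
def reflFun (m : ℕ) (i : Fin m) (u : Vec m) : Vec m := fun j => if j = i then -u j else u j

/-- The reflection negating the `i`-th coordinate, as a linear map. -/
def reflLin (m : ℕ) (i : Fin m) : Vec m →ₗ[ℝ] Vec m :=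
  LinearMap.pi fun j => if j = i then -LinearMap.proj j else LinearMap.proj j

/-- Pullback of an ambient form along the reflection `R_i`. -/
def reflPull (m k : ℕ) (i : Fin m) (α : Form m k) : Form m k :=
  fun x => (α (reflFun m i x)).compLinearMap (reflLin m i)

/-- A form on `ℝ^m` is even if it is invariant under all coordinate reflections. -/
def IsEven (m k : ℕ) (α : Form m k) : Prop := ∀ i, reflPull m k i α = α

/-- A form on `ℝ^m` is odd if every coordinate reflection negates it. -/
def IsOdd (m k : ℕ) (α : Form m k) : Prop := ∀ i, reflPull m k i α = -α

/-- The map `Φ(u) = (u₁², …, u_m²)`. -/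
def Phi (m : ℕ) (u : Vec m) : Vec m := fun i => u i ^ 2

/-- The differential of `Φ` at `u`. -/
def dPhi (m : ℕ) (u : Vec m) : Vec m →ₗ[ℝ] Vec m :=
  LinearMap.pi fun i => (2 * u i) • LinearMap.proj i

/-- Pullback of ambient forms along `Φ`. -/
def phiPull (m k : ℕ) (α : Form m k) : Form m k :=
  fun u => (α (Phi m u)).compLinearMap (dPhi m u)

/-- The standard simplex `T^{m-1} ⊂ ℝ^m`. -/
def simplexSet (m : ℕ) : Set (Vec m) := {x | (∀ i, 0 ≤ x i) ∧ ∑ i, x i = 1}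

/-- The unit sphere `S^{m-1} ⊂ ℝ^m`. -/
def sphereSet (m : ℕ) : Set (Vec m) := {u | ∑ i, u i ^ 2 = 1}

/-- The linear functional `v ↦ ⟨u, v⟩`. -/
def dotLin (m : ℕ) (u : Vec m) : Vec m →ₗ[ℝ] ℝ := ∑ i, u i • LinearMap.proj i

/-- Orthogonal projection onto the tangent space of the sphere at `u`. -/
def projSph (m : ℕ) (u : Vec m) : Vec m →ₗ[ℝ] Vec m :=
  LinearMap.id - (dotLin m u).smulRight u

/-- The linear functional `v ↦ Σ vᵢ`. -/
def sumLin (m : ℕ) : Vec m →ₗ[ℝ] ℝ := ∑ i, LinearMap.proj i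

/-- Orthogonal projection onto the tangent hyperplane `{Σ vᵢ = 0}` of the simplex. -/
def projSim (m : ℕ) : Vec m →ₗ[ℝ] Vec m :=
  LinearMap.id - ((m : ℝ)⁻¹ • sumLin m).smulRight (fun _ => 1)

/-- Differential `k`-forms on a subset `M ⊆ ℝ^m`, encoded at each point by the canonical
alternating tensor on `ℝ^m` that vanishes in the directions normal to `M` (i.e. the
pullback along the inclusion, extended by the tangent projection). -/
abbrev FormOn (m : ℕ) (M : Set (Vec m)) (k : ℕ) := M → (Vec m [⋀^Fin k]→ₗ[ℝ] ℝ)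

/-- Restriction (pullback along the inclusion) of an ambient form to the simplex. -/
def resSim (m k : ℕ) (α : Form m k) : FormOn m (simplexSet m) k :=
  fun x => (α x.1).compLinearMap (projSim m)

/-- Restriction (pullback along the inclusion) of an ambient form to the sphere. -/
def resSph (m k : ℕ) (α : Form m k) : FormOn m (sphereSet m) k :=
  fun u => (α u.1).compLinearMap (projSph m u.1)

/-- `P_rΛ^k(T^{m-1})`. -/
def PLsim (m k : ℕ) (r : ℤ) : Set (FormOn m (simplexSet m) k) := resSim m k '' PL m k r

/-- `P_rΛ^k(S^{m-1})`. -/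
def PLsph (m k : ℕ) (r : ℤ) : Set (FormOn m (sphereSet m) k) := resSph m k '' PL m k r

/-- `P_r⁻Λ^k(T^{m-1})`. -/
def PLmsim (m k : ℕ) (r : ℤ) : Set (FormOn m (simplexSet m) k) := resSim m k '' PLm m k r

/-- `P_r⁻Λ^k(S^{m-1})`. -/
def PLmsph (m k : ℕ) (r : ℤ) : Set (FormOn m (sphereSet m) k) := resSph m k '' PLm m k r

lemma phi_mem_simplex {m : ℕ} {u : Vec m} (hu : u ∈ sphereSet m) :
    Phi m u ∈ simplexSet m :=
  ⟨fun _ => sq_nonneg _, hu⟩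

/-- Pullback `Φ^* : Λ^k(T^{m-1}) → Λ^k(S^{m-1})` along `Φ : S^{m-1} → T^{m-1}`. -/
def phiPullTS (m k : ℕ) (a : FormOn m (simplexSet m) k) : FormOn m (sphereSet m) k :=
  fun u => (a ⟨Phi m u.1, phi_mem_simplex u.2⟩).compLinearMap
    ((dPhi m u.1).comp (projSph m u.1))

lemma refl_mem_sphere {m : ℕ} {i : Fin m} {u : Vec m} (hu : u ∈ sphereSet m) :
    reflFun m i u ∈ sphereSet m := by
  have : ∀ j, (reflFun m i u j) ^ 2 = u j ^ 2 := by
    intro j; simp only [reflFun]; split <;> ring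
  simpa only [sphereSet, Set.mem_setOf_eq, this] using hu

/-- Pullback of a form on the sphere along the reflection `R_i`. -/
def reflPullSph (m k : ℕ) (i : Fin m) (α : FormOn m (sphereSet m) k) :
    FormOn m (sphereSet m) k :=
  fun u => (α ⟨reflFun m i u.1, refl_mem_sphere u.2⟩).compLinearMap (reflLin m i)

/-- A form on the sphere is even if it is invariant under all coordinate reflections. -/
def IsEvenSph (m k : ℕ) (α : FormOn m (sphereSet m) k) : Prop :=
  ∀ i, reflPullSph m k i α = α

/-- A form on the sphere is odd if every coordinate reflection negates it. -/
def IsOddSph (m k : ℕ) (α : FormOn m (sphereSet m) k) : Prop :=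
  ∀ i, reflPullSph m k i α = -α

/-- The bubble function `u_N = u₁ ⋯ u_m`. -/
def bubble (m : ℕ) (u : Vec m) : ℝ := ∏ i, u i

/-- Multiplication of a form on the sphere by the bubble function. -/
def bubbleSmul (m k : ℕ) (α : FormOn m (sphereSet m) k) : FormOn m (sphereSet m) k :=
  fun u => bubble m u.1 • α u

/-- Multiplication of an ambient form by the bubble function. -/
def bubbleSmulAmb (m k : ℕ) (α : Form m k) : Form m k :=
  fun u => bubble m u • α u

/-- The standard volume form on `ℝ^m`. -/
def volForm (m : ℕ) : (Vec m) [⋀^Fin m]→ₗ[ℝ] ℝ := (Pi.basisFun ℝ (Fin m)).det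

/-- Iterated interior product: insert the vectors `v 0, …, v (k-1)` into the
first `k` slots of an alternating `(k+j)`-tensor. -/
def contrMany {m : ℕ} : (k : ℕ) → (Fin k → Vec m) → {j : ℕ} →
    ((Vec m) [⋀^Fin (k + j)]→ₗ[ℝ] ℝ) → ((Vec m) [⋀^Fin j]→ₗ[ℝ] ℝ)
  | 0, _, j, α => α.domDomCongr (finCongr (Nat.zero_add j))
  | (k + 1), v, j, α =>
      contrMany k (fun i => v i.succ)
        ((α.domDomCongr (finCongr (by omega : (k + 1) + j = (k + j) + 1))).curryLeft (v 0))

/-- The Hodge star on alternating tensors on `ℝ^m` (standard metric and orientation):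
`(⋆α)(w₁,…,w_{m-k}) = (1/k!) Σ_g α(e_{g 0},…,e_{g(k-1)}) vol(e_{g 0},…,e_{g(k-1)},w₁,…,w_{m-k})`. -/
def starAlt (m k : ℕ) (α : (Vec m) [⋀^Fin k]→ₗ[ℝ] ℝ) : (Vec m) [⋀^Fin (m - k)]→ₗ[ℝ] ℝ :=
  if h : k ≤ m then
    (k.factorial : ℝ)⁻¹ •
      ∑ g : Fin k → Fin m,
        α (fun i => Pi.single (g i) 1) •
          contrMany k (fun i => Pi.single (g i) 1)
            ((volForm m).domDomCongr (finCongr (by omega : m = k + (m - k))))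
  else 0

/-- The Hodge star `⋆_{ℝ^m}` applied pointwise to ambient forms. -/
def starR (m k : ℕ) (α : Form m k) : Form m (m - k) := fun x => starAlt m k (α x)

/-- The wedge product of alternating tensors. -/
def wedgeAlt {m k l : ℕ} (α : (Vec m) [⋀^Fin k]→ₗ[ℝ] ℝ) (β : (Vec m) [⋀^Fin l]→ₗ[ℝ] ℝ) :
    (Vec m) [⋀^Fin (k + l)]→ₗ[ℝ] ℝ :=
  ((TensorProduct.lid ℝ ℝ).toLinearMap.compAlternatingMap (α.domCoprod β)).domDomCongr
    finSumFinEquiv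

/-- The conormal `ν = Σ uᵢ duᵢ` at `u`, as an alternating 1-tensor. -/
def nuForm (m : ℕ) (u : Vec m) : (Vec m) [⋀^Fin 1]→ₗ[ℝ] ℝ :=
  AlternatingMap.ofSubsingleton ℝ (Vec m) ℝ (0 : Fin 1) (dotLin m u)

/-- The extended Hodge star `⋆_{S^{m-1}} α := ⋆_{ℝ^m}(ν ∧ α)` on ambient forms. -/
def starSphAmb (m k : ℕ) (α : Form m k) : Form m (m - (1 + k)) :=
  fun x => starAlt m (1 + k) (wedgeAlt (nuForm m x) (α x))

/-- The Hodge star of a form on the sphere (w.r.t. the round metric and the orientation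
induced by the outward normal), computed as the restriction of `⋆_{ℝ^m}(ν ∧ ·)`. -/
def starSph (m k : ℕ) (α : FormOn m (sphereSet m) k) :
    FormOn m (sphereSet m) (m - (1 + k)) :=
  fun u => (starAlt m (1 + k) (wedgeAlt (nuForm m u.1) (α u))).compLinearMap (projSph m u.1)

/-- Re-indexing a form along an equality of form degrees. -/
def castForm {m k l : ℕ} (h : k = l) (α : Form m k) : Form m l :=
  fun x => (α x).domDomCongr (finCongr h)

/-- Re-indexing a form on a subset along an equality of form degrees. -/
def castFormOn {m : ℕ} {M : Set (Vec m)} {k l : ℕ} (h : k = l) (α : FormOn m M k) :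
    FormOn m M l :=
  fun x => (α x).domDomCongr (finCongr h)

/-- Trace on the boundary of the simplex vanishes: at every boundary point (a point of some
face `xᵢ = 0`), the form vanishes on vectors tangent to that face. -/
def vanishBdry (m k : ℕ) (a : FormOn m (simplexSet m) k) : Prop :=
  ∀ (x : simplexSet m) (i : Fin m), x.1 i = 0 →
    ∀ v : Fin k → Vec m, (∀ j, (∑ l, v j l) = 0 ∧ v j i = 0) → a x v = 0

/-- `P̊_rΛ^k(T^{m-1})`: forms in `P_rΛ^k(T^{m-1})` with vanishing trace on the boundary. -/
def PLosim (m k : ℕ) (r : ℤ) : Set (FormOn m (simplexSet m) k) :=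
  {a ∈ PLsim m k r | vanishBdry m k a}

/-- `P̊_r⁻Λ^k(T^{m-1})`. -/
def PLmosim (m k : ℕ) (r : ℤ) : Set (FormOn m (simplexSet m) k) :=
  {a ∈ PLmsim m k r | vanishBdry m k a}

/-- A form on the sphere vanishes (as an alternating tensor on the tangent space)
at every point of `S^{m-1} ∩ Γ`, where `Γ = ∪ᵢ {uᵢ = 0}`. -/
def zeroOnGammaSph (m k : ℕ) (α : FormOn m (sphereSet m) k) : Prop :=
  ∀ u : sphereSet m, (∃ i, u.1 i = 0) →
    ∀ v : Fin k → Vec m, (∀ j, ∑ l, u.1 l * v j l = 0) → α u v = 0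

/-- An ambient form vanishes (as an alternating tensor) at every point of `Γ`. -/
def zeroOnGammaAmb (m k : ℕ) (α : Form m k) : Prop :=
  ∀ u : Vec m, (∃ i, u i = 0) → α u = 0

/-- The wedge product of forms on a subset. -/
def wedgeOn {m : ℕ} {M : Set (Vec m)} {k l : ℕ} (a : FormOn m M k) (b : FormOn m M l) :
    FormOn m M (k + l) :=
  fun x => wedgeAlt (a x) (b x)

/-- The base region of the parametrization of the simplex. -/
def baseSimplex (n : ℕ) : Set (Fin n → ℝ) := {y | (∀ j, 0 ≤ y j) ∧ ∑ j, y j ≤ 1}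

/-- Parametrization `y ↦ (1 - Σy, y)` of `T^n` over the base region. -/
def simplexParam (n : ℕ) (y : Fin n → ℝ) : Vec (n + 1) := Fin.cons (1 - ∑ j, y j) y

lemma simplexParam_mem {n : ℕ} {y : Fin n → ℝ} (h : y ∈ baseSimplex n) :
    simplexParam n y ∈ simplexSet (n + 1) := by
  constructor
  · intro i
    refine Fin.cases ?_ ?_ i
    · simpa [simplexParam] using sub_nonneg.mpr h.2
    · intro j; simpa [simplexParam] using h.1 j
  · simp [simplexParam, Fin.sum_cons]

/-- The coordinate tangent vectors `∂x/∂y_j = e_{j+1} - e_0` of the parametrization,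
a positively oriented frame for the orientation of `T^n` induced from the outward-normal
orientation of `S^n` via `Φ`. -/
def simplexTangent (n : ℕ) (j : Fin n) : Vec (n + 1) :=
  Fin.cons (-1) (Pi.single j 1)

open Classical in
/-- The integral of an `n`-form over the oriented simplex `T^n`. -/
def integralSimplex (n : ℕ) (ω : FormOn (n + 1) (simplexSet (n + 1)) n) : ℝ :=
  ∫ y : Fin n → ℝ,
    if h : y ∈ baseSimplex n then ω ⟨simplexParam n y, simplexParam_mem h⟩ (simplexTangent n)
    else 0

/-- Forms on a subset that genuinely are pullbacks to the simplex: they vanish in the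
normal directions (canonical representatives). -/
def TangentialSim (m k : ℕ) (a : FormOn m (simplexSet m) k) : Prop :=
  ∀ x, (a x).compLinearMap (projSim m) = a x

/-- Continuity of a form on a subset. -/
def ContFormOn (m : ℕ) (M : Set (Vec m)) (k : ℕ) (a : FormOn m M k) : Prop :=
  ∀ v : Fin k → Vec m, Continuous fun x : M => a x v

/-- The Riemannian volume form of the round sphere `S^{m-1}` (outward-normal orientation),
i.e. the restriction of `⋆_{ℝ^m} ν`. -/
def volSph (m : ℕ) : FormOn m (sphereSet m) (m - 1) :=
  fun u => (starAlt m 1 (nuForm m u.1)).compLinearMap (projSph m u.1)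



section MonomialMaps

open MvPolynomial

variable {m : ℕ}

lemma degLE_iff {r : ℤ} {p : MvPolynomial (Fin m) ℝ} :
    degLE r p ↔ ∀ d ∈ p.support, ((∑ i, d i : ℕ) : ℤ) ≤ r := by
  simp only [degLE]
  refine forall₂_congr fun d _ => ?_
  rw [Finsupp.sum_fintype _ _ (by simp)]

lemma degLE_sum {ι : Type*} {r : ℤ} (s : Finset ι) (p : ι → MvPolynomial (Fin m) ℝ)
    (h : ∀ i ∈ s, degLE r (p i)) : degLE r (∑ i ∈ s, p i) := by
  classical
  intro d hd
  obtain ⟨i, hi, hdi⟩ := Finset.mem_biUnion.mp (support_sum hd)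
  exact h i hi d hdi

lemma degLE_smul {r : ℤ} (c : ℝ) {p : MvPolynomial (Fin m) ℝ} (h : degLE r p) :
    degLE r (c • p) := fun d hd => h d (support_smul hd)

lemma degLE_zero {r : ℤ} : degLE r (0 : MvPolynomial (Fin m) ℝ) := by
  simp [degLE]

lemma degLE_add {r : ℤ} {p q : MvPolynomial (Fin m) ℝ} (hp : degLE r p) (hq : degLE r q) :
    degLE r (p + q) := by
  classical
  intro d hd
  rcases Finset.mem_union.mp (support_add hd) with h | h
  exacts [hp d h, hq d h]

/-- The linear map on polynomials sending `X^d` to `F d`. -/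
def polyMap (F : (Fin m →₀ ℕ) → MvPolynomial (Fin m) ℝ) :
    MvPolynomial (Fin m) ℝ →ₗ[ℝ] MvPolynomial (Fin m) ℝ :=
  (basisMonomials (Fin m) ℝ).constr ℝ F

lemma polyMap_apply (F : (Fin m →₀ ℕ) → MvPolynomial (Fin m) ℝ) (p : MvPolynomial (Fin m) ℝ) :
    polyMap F p = ∑ d ∈ p.support, p.coeff d • F d := by
  conv_lhs => rw [← support_sum_monomial_coeff p]
  rw [map_sum]
  refine Finset.sum_congr rfl fun d _ => ?_
  have : monomial d (coeff d p) = coeff d p • (basisMonomials (Fin m) ℝ d) := by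
    simp [smul_monomial]
  rw [this, map_smul, polyMap, Module.Basis.constr_basis]

/-- The linear map on polynomials sending `X^d` to `c d • X^(h d)`. -/
def monoMap (h : (Fin m →₀ ℕ) → (Fin m →₀ ℕ)) (c : (Fin m →₀ ℕ) → ℝ) :
    MvPolynomial (Fin m) ℝ →ₗ[ℝ] MvPolynomial (Fin m) ℝ :=
  polyMap fun d => monomial (h d) (c d)

lemma eval_monoMap (h : (Fin m →₀ ℕ) → (Fin m →₀ ℕ)) (c : (Fin m →₀ ℕ) → ℝ)
    (p : MvPolynomial (Fin m) ℝ) (x : Vec m) :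
    eval x (monoMap h c p) = ∑ d ∈ p.support, p.coeff d * (c d * ∏ i, x i ^ h d i) := by
  simp [monoMap, polyMap_apply, smul_eval, eval_monomial, Finsupp.prod_fintype]

lemma degLE_monoMap (h : (Fin m →₀ ℕ) → (Fin m →₀ ℕ)) (c : (Fin m →₀ ℕ) → ℝ)
    {p : MvPolynomial (Fin m) ℝ} {r : ℤ}
    (hr : ∀ d ∈ p.support, ((∑ i, h d i : ℕ) : ℤ) ≤ r) : degLE r (monoMap h c p) := by
  classical
  rw [monoMap, polyMap_apply]
  refine degLE_sum _ _ fun d hd => degLE_smul _ (degLE_iff.2 fun e he => ?_)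
  rw [Finset.mem_singleton.1 (support_monomial_subset he)]
  exact hr d hd

lemma coeff_monoMap_id (c : (Fin m →₀ ℕ) → ℝ) (p : MvPolynomial (Fin m) ℝ) (d : Fin m →₀ ℕ) :
    coeff d (monoMap id c p) = c d * coeff d p := by
  classical
  rw [monoMap, polyMap_apply, coeff_sum]
  simp only [coeff_smul, id, coeff_monomial, smul_eq_mul, mul_ite, mul_zero, Finset.sum_ite_eq',
    mem_support_iff]
  split_ifs with hd
  · ring
  · simp [not_not.1 hd]

lemma support_monoMap_id {c : (Fin m →₀ ℕ) → ℝ} {p : MvPolynomial (Fin m) ℝ} {d : Fin m →₀ ℕ}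
    (hd : d ∈ (monoMap id c p).support) : c d ≠ 0 ∧ d ∈ p.support := by
  rw [mem_support_iff, coeff_monoMap_id] at hd
  exact ⟨left_ne_zero_of_mul hd, mem_support_iff.2 (right_ne_zero_of_mul hd)⟩

/-- The exponent `⌊(d + 1) / 2⌋`, taken coordinatewise. -/
def halfUp (d : Fin m →₀ ℕ) : Fin m →₀ ℕ := Finsupp.equivFunOnFinite.symm fun i => (d i + 1) / 2

/-- The substitution `X^d ↦ X^⌊(d + 1) / 2⌋`. -/
def halfMap : MvPolynomial (Fin m) ℝ →ₗ[ℝ] MvPolynomial (Fin m) ℝ := monoMap halfUp fun _ => 1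

lemma prod_mem_eq_ite (S : Finset (Fin m)) (u : Vec m) :
    ∏ i ∈ S, u i = ∏ i, if i ∈ S then u i else 1 := by
  simp [Finset.prod_ite_mem]

lemma eval_halfMap {p : MvPolynomial (Fin m) ℝ} {S : Finset (Fin m)}
    (hp : ∀ d ∈ p.support, ∀ i, (i ∈ S ↔ Even (d i))) (u : Vec m) :
    (∏ i ∈ S, u i) * eval (Phi m u) (halfMap p) = bubble m u * eval u p := by
  rw [halfMap, eval_monoMap, eval_eq', Finset.mul_sum, Finset.mul_sum]
  refine Finset.sum_congr rfl fun d hd => ?_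
  suffices h : (∏ i ∈ S, u i) * ∏ i, Phi m u i ^ halfUp d i = bubble m u * ∏ i, u i ^ d i by
    linear_combination (coeff d p) * h
  rw [prod_mem_eq_ite, bubble, ← Finset.prod_mul_distrib, ← Finset.prod_mul_distrib]
  refine Finset.prod_congr rfl fun i _ => ?_
  simp only [Phi, halfUp, Finsupp.equivFunOnFinite_symm_apply_apply, ← pow_mul]
  have := hp d hd i
  split_ifs with hi
  · obtain ⟨e, he⟩ := this.1 hi
    rw [he, show 2 * ((e + e + 1) / 2) = e + e by omega]
  · obtain ⟨e, he⟩ := Nat.not_even_iff_odd.1 (mt this.2 hi)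
    rw [he, show 2 * ((2 * e + 1 + 1) / 2) = 2 * e + 1 + 1 by omega]
    ring

lemma degLE_halfMap {p : MvPolynomial (Fin m) ℝ} {S : Finset (Fin m)} {s r : ℤ}
    (hp : ∀ d ∈ p.support, ∀ i, (i ∈ S ↔ Even (d i))) (hs : degLE s p)
    (hr : s + m - S.card ≤ 2 * r + 1) : degLE r (halfMap p) := by
  refine degLE_monoMap _ _ fun d hd => ?_
  have h1 := degLE_iff.1 hs d hd
  have h2 : 2 * ∑ i, halfUp d i + S.card = ∑ i, d i + m := by
    have : S.card = ∑ i, if i ∈ S then 1 else 0 := by simp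
    suffices 2 * ∑ i, halfUp d i + S.card = ∑ i, d i + ∑ i : Fin m, 1 by simpa using this
    rw [this, Finset.mul_sum, ← Finset.sum_add_distrib, ← Finset.sum_add_distrib]
    refine Finset.sum_congr rfl fun i _ => ?_
    simp only [halfUp, Finsupp.equivFunOnFinite_symm_apply_apply]
    have := hp d hd i
    split_ifs with hi
    · obtain ⟨e, he⟩ := this.1 hi
      omega
    · obtain ⟨e, he⟩ := Nat.not_even_iff_odd.1 (mt this.2 hi)
      omega
  have h3 : (2 * ((∑ i, halfUp d i : ℕ) : ℤ)) + S.card = ((∑ i, d i : ℕ) : ℤ) + m := by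
    exact_mod_cast h2
  omega

lemma eval_halfMap_eq_zero {p : MvPolynomial (Fin m) ℝ} {S : Finset (Fin m)}
    (hp : ∀ d ∈ p.support, ∀ i, (i ∈ S ↔ Even (d i))) {x : Vec m} {i : Fin m} (hi : i ∉ S)
    (hx : x i = 0) : eval x (halfMap p) = 0 := by
  rw [halfMap, eval_monoMap]
  refine Finset.sum_eq_zero fun d hd => ?_
  obtain ⟨e, he⟩ := Nat.not_even_iff_odd.1 (mt (hp d hd i).2 hi)
  rw [Finset.prod_eq_zero (Finset.mem_univ i)]
  · simp
  · rw [hx, zero_pow]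
    simp only [halfUp, Finsupp.equivFunOnFinite_symm_apply_apply]
    omega

lemma exists_quotient_bubble {p : MvPolynomial (Fin m) ℝ} {S : Finset (Fin m)} {r s : ℤ}
    (hp : ∀ d ∈ p.support, ∀ i, i ∉ S → d i ≠ 0) (hr : degLE r p)
    (hs : 2 * r + S.card - m ≤ s) :
    ∃ q, degLE s q ∧ ∀ u, (∏ i ∈ S, u i) * eval (Phi m u) p = bubble m u * eval u q := by
  set h : (Fin m →₀ ℕ) → (Fin m →₀ ℕ) := fun d =>
    Finsupp.equivFunOnFinite.symm fun i => if i ∈ S then 2 * d i else 2 * d i - 1 with hh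
  refine ⟨monoMap h (fun _ => 1) p, degLE_monoMap _ _ fun d hd => ?_, fun u => ?_⟩
  · have h1 := degLE_iff.1 hr d hd
    have h2 : ∑ i, h d i + m = 2 * ∑ i, d i + S.card := by
      have : S.card = ∑ i, if i ∈ S then 1 else 0 := by simp
      suffices ∑ i, h d i + ∑ i : Fin m, 1 = 2 * ∑ i, d i + S.card by simpa using this
      rw [this, Finset.mul_sum, ← Finset.sum_add_distrib, ← Finset.sum_add_distrib]
      refine Finset.sum_congr rfl fun i _ => ?_
      have := hp d hd i
      simp only [hh, Finsupp.equivFunOnFinite_symm_apply_apply]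
      split_ifs with hi
      · rfl
      · have := this hi
        omega
    have h3 : ((∑ i, h d i : ℕ) : ℤ) + m = 2 * ((∑ i, d i : ℕ) : ℤ) + S.card := by
      exact_mod_cast h2
    omega
  · rw [eval_monoMap, eval_eq', Finset.mul_sum, Finset.mul_sum]
    refine Finset.sum_congr rfl fun d hd => ?_
    suffices H : (∏ i ∈ S, u i) * ∏ i, Phi m u i ^ d i = bubble m u * ∏ i, u i ^ h d i by
      linear_combination (coeff d p) * H
    rw [prod_mem_eq_ite, bubble, ← Finset.prod_mul_distrib, ← Finset.prod_mul_distrib]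
    refine Finset.prod_congr rfl fun i _ => ?_
    simp only [Phi, hh, Finsupp.equivFunOnFinite_symm_apply_apply, ← pow_mul]
    split_ifs with hi
    · rfl
    · obtain ⟨e, he⟩ := Nat.exists_eq_succ_of_ne_zero (hp d hd i hi)
      rw [he, show 2 * e.succ - 1 = 2 * e + 1 by omega, Nat.succ_eq_add_one]
      ring

end MonomialMaps

section Homogenization

open MvPolynomial

variable {m : ℕ}

/-- Homogenization to degree `r` by powers of the sum of the coordinates. -/
def homog (r : ℕ) : MvPolynomial (Fin m) ℝ →ₗ[ℝ] MvPolynomial (Fin m) ℝ :=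
  polyMap fun d => monomial d 1 * (∑ i, X i) ^ (r - ∑ i, d i)

lemma homog_isHomogeneous {r : ℕ} {p : MvPolynomial (Fin m) ℝ} (hp : degLE r p) :
    (homog r p).IsHomogeneous r := by
  rw [homog, polyMap_apply]
  refine IsHomogeneous.sum _ _ _ fun d hd => ?_
  have h : ∑ i, d i ≤ r := by exact_mod_cast degLE_iff.1 hp d hd
  rw [smul_eq_C_mul]
  refine IsHomogeneous.C_mul ?_ _
  have h1 : (monomial d (1 : ℝ)).IsHomogeneous (∑ i, d i) :=
    isHomogeneous_monomial _ (by rw [Finsupp.degree_eq_sum])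
  have h2 : (∑ i : Fin m, (X i : MvPolynomial (Fin m) ℝ)).IsHomogeneous 1 :=
    IsHomogeneous.sum _ _ _ fun i _ => isHomogeneous_X _ i
  have h3 := h1.mul (h2.pow (r - ∑ i, d i))
  rwa [one_mul, Nat.add_sub_cancel' h] at h3

lemma eval_homog (r : ℕ) (p : MvPolynomial (Fin m) ℝ) {x : Vec m} (hx : ∑ i, x i = 1) :
    eval x (homog r p) = eval x p := by
  rw [homog, polyMap_apply, map_sum, eval_eq']
  refine Finset.sum_congr rfl fun d _ => ?_
  simp [smul_eval, eval_monomial, Finsupp.prod_fintype, hx]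

lemma sum_eq_of_isHomogeneous {r : ℕ} {p : MvPolynomial (Fin m) ℝ} (hp : p.IsHomogeneous r)
    {d : Fin m →₀ ℕ} (hd : d ∈ p.support) : ∑ i, d i = r := by
  rw [← Finsupp.degree_eq_sum]
  by_contra h
  exact mem_support_iff.1 hd (hp.coeff_eq_zero h)

lemma eval_smul_of_isHomogeneous {r : ℕ} {p : MvPolynomial (Fin m) ℝ} (hp : p.IsHomogeneous r)
    (c : ℝ) (x : Vec m) : eval (c • x) p = c ^ r * eval x p := by
  rw [eval_eq', eval_eq', Finset.mul_sum]
  refine Finset.sum_congr rfl fun d hd => ?_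
  simp only [Pi.smul_apply, smul_eq_mul, mul_pow, Finset.prod_mul_distrib,
    Finset.prod_pow_eq_pow_sum, sum_eq_of_isHomogeneous hp hd]
  ring

lemma eval_homog_eq_zero {r : ℕ} {p : MvPolynomial (Fin m) ℝ} (hp : degLE r p) {y : Vec m}
    (hy : 0 < ∑ i, y i) (h : eval ((∑ i, y i)⁻¹ • y) p = 0) : eval y (homog r p) = 0 := by
  set σ := ∑ i, y i
  have h1 : y = σ • (σ⁻¹ • y) := by rw [smul_smul, mul_inv_cancel₀ hy.ne', one_smul]
  rw [h1, eval_smul_of_isHomogeneous (homog_isHomogeneous hp), eval_homog, h, mul_zero]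
  simp only [Pi.smul_apply, smul_eq_mul, ← Finset.mul_sum]
  exact inv_mul_cancel₀ hy.ne'

lemma eq_zero_of_eval_pos {p : MvPolynomial (Fin m) ℝ}
    (h : ∀ x : Vec m, (∀ i, 0 < x i) → eval x p = 0) : p = 0 := by
  refine funext_set (fun _ => Set.Ioi (0 : ℝ)) (fun _ => Set.Ioi_infinite 0) fun x hx => ?_
  rw [h x fun i => hx i (Set.mem_univ i), map_zero]

lemma eval_eq_zero_of_interior {r : ℕ} {p : MvPolynomial (Fin m) ℝ} (hp : degLE r p)
    (h : ∀ x : Vec m, (∀ i, 0 < x i) → ∑ i, x i = 1 → eval x p = 0) {x : Vec m}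
    (hx : ∑ i, x i = 1) : eval x p = 0 := by
  have hm : 0 < m := by
    rcases Nat.eq_zero_or_pos m with rfl | h
    · simp at hx
    · exact h
  have : Nonempty (Fin m) := ⟨⟨0, hm⟩⟩
  rw [← eval_homog r p hx, eq_zero_of_eval_pos (p := homog r p), map_zero]
  intro y hy
  have hpos : 0 < ∑ i, y i := Finset.sum_pos (fun i _ => hy i) Finset.univ_nonempty
  refine eval_homog_eq_zero hp hpos (h _ (fun i => mul_pos (inv_pos.2 hpos) (hy i)) ?_)
  simp only [Pi.smul_apply, smul_eq_mul, ← Finset.mul_sum]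
  exact inv_mul_cancel₀ hpos.ne'

lemma ne_zero_of_mem_support_homog {r : ℕ} {p : MvPolynomial (Fin m) ℝ} (hp : degLE r p)
    (hm : 2 ≤ m) (l : Fin m) (h : ∀ x ∈ simplexSet m, x l = 0 → eval x p = 0)
    {d : Fin m →₀ ℕ} (hd : d ∈ (homog r p).support) : d l ≠ 0 := by
  intro hdl
  set q := monoMap id (fun d => if d l = 0 then 1 else 0) (homog r p) with hq
  have hq0 : q = 0 := by
    refine eq_zero_of_eval_pos fun x hx => ?_
    have hnn : ∀ i, 0 ≤ Function.update x l 0 i := by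
      intro i
      by_cases hi : i = l
      · simp [hi]
      · simpa [hi] using (hx i).le
    have hpos : 0 < ∑ i, Function.update x l 0 i := by
      have : Nontrivial (Fin m) := Fin.nontrivial_iff_two_le.2 hm
      obtain ⟨j, hj⟩ := exists_ne l
      refine Finset.sum_pos' (fun i _ => hnn i) ⟨j, Finset.mem_univ j, ?_⟩
      simpa [hj] using hx j
    have h1 : eval x q = eval (Function.update x l 0) (homog r p) := by
      rw [hq, eval_monoMap, eval_eq']
      refine Finset.sum_congr rfl fun e _ => ?_
      congr 1
      split_ifs with he
      · rw [one_mul]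
        refine Finset.prod_congr rfl fun i _ => ?_
        by_cases hi : i = l
        · subst hi; simp [he]
        · simp [hi]
      · rw [zero_mul, Finset.prod_eq_zero (Finset.mem_univ l)]
        simp [he]
    rw [h1]
    refine eval_homog_eq_zero hp hpos (h _ ⟨fun i => ?_, ?_⟩ ?_)
    · exact mul_nonneg (inv_nonneg.2 hpos.le) (hnn i)
    · simp only [Pi.smul_apply, smul_eq_mul, ← Finset.mul_sum]
      exact inv_mul_cancel₀ hpos.ne'
    · simp
  have h2 : coeff d q = coeff d (homog r p) := by
    rw [hq, coeff_monoMap_id, if_pos hdl, one_mul]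
  rw [hq0, coeff_zero] at h2
  exact mem_support_iff.1 hd h2.symm

end Homogenization

section PolynomialForms

open MvPolynomial

variable {m k : ℕ}

lemma alternating_expand {N : Type*} [AddCommGroup N] [Module ℝ N]
    (g : Vec m [⋀^Fin k]→ₗ[ℝ] N) (v : Fin k → Vec m) :
    g v = ∑ f : Fin k → Fin m, (∏ l, v l (f l)) • g fun l => Pi.single (f l) 1 := by
  have hv : v = fun l => ∑ i, v l i • (Pi.single i 1 : Vec m) := by
    funext l
    exact (pi_eq_sum_univ' (v l)).trans (by simp)
  conv_lhs => rw [hv]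
  have h1 := g.toMultilinearMap.map_sum (fun l i => v l i • (Pi.single i 1 : Vec m))
  refine h1.trans (Finset.sum_congr rfl fun f _ => ?_)
  exact g.toMultilinearMap.map_smul_univ (fun l => v l (f l)) _

lemma alternating_ext {N : Type*} [AddCommGroup N] [Module ℝ N]
    {g h : Vec m [⋀^Fin k]→ₗ[ℝ] N}
    (H : ∀ f : Fin k → Fin m, Function.Injective f →
      g (fun l => Pi.single (f l) 1) = h fun l => Pi.single (f l) 1) : g = h :=
  (Pi.basisFun ℝ (Fin m)).ext_alternating fun f hf => by simpa using H f hf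

lemma alternating_single_eq_zero {N : Type*} [AddCommGroup N] [Module ℝ N]
    (g : Vec m [⋀^Fin k]→ₗ[ℝ] N) {f : Fin k → Fin m} (hf : ¬ Function.Injective f) :
    (g fun l => Pi.single (f l) 1) = 0 := by
  refine g.map_eq_zero_of_not_injective _ fun h => hf fun a b hab => h ?_
  simp only [hab]

/-- If each coefficient of a form is a polynomial multiple of a fixed nonzero polynomial, the
quotients form an alternating map with polynomial values. -/
lemma exists_polyForm_mul {N : MvPolynomial (Fin m) ℝ} (hN : N ≠ 0) {s : ℤ} {γ : Form m k}
    (h : ∀ v, ∃ q, degLE s q ∧ ∀ u, γ u v = eval u N * eval u q) :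
    ∃ B : Vec m [⋀^Fin k]→ₗ[ℝ] MvPolynomial (Fin m) ℝ, (∀ v, degLE s (B v)) ∧
      ∀ u v, γ u v = eval u N * eval u (B v) := by
  choose q hq hγ using h
  have key : ∀ a b : MvPolynomial (Fin m) ℝ,
      (∀ u, eval u N * eval u a = eval u N * eval u b) → a = b := fun a b hab =>
    mul_left_cancel₀ hN (MvPolynomial.funext fun u => by simpa using hab u)
  refine ⟨{ toFun := q, map_update_add' := ?_, map_update_smul' := ?_,
            map_eq_zero_of_eq' := ?_ }, hq, fun u v => hγ v u⟩
  · intro _ v i x y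
    refine key _ _ fun u => ?_
    rw [map_add, mul_add, ← hγ, ← hγ, ← hγ]
    convert (γ u).map_update_add v i x y
  · intro _ v i c x
    refine key _ _ fun u => ?_
    rw [smul_eval, mul_left_comm, ← hγ, ← hγ]
    rw [← smul_eq_mul]
    convert (γ u).map_update_smul v i c x
  · intro v i j hij hne
    refine key _ _ fun u => ?_
    rw [← hγ, (γ u).map_eq_zero_of_eq v hij hne, map_zero, mul_zero]

lemma exists_polyForm {r : ℤ} {α : Form m k} (hα : α ∈ PL m k r) :
    ∃ A : Vec m [⋀^Fin k]→ₗ[ℝ] MvPolynomial (Fin m) ℝ, (∀ v, degLE r (A v)) ∧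
      ∀ x v, α x v = eval x (A v) := by
  obtain ⟨A, hA, h⟩ := exists_polyForm_mul (one_ne_zero) (s := r) (γ := α) fun v => by
    obtain ⟨p, hp, h⟩ := hα v
    exact ⟨p, hp, fun u => by simp [h]⟩
  exact ⟨A, hA, fun x v => by simp [h]⟩

/-- The form on `ℝ^m` defined by an alternating map with polynomial values. -/
def evalForm (A : Vec m [⋀^Fin k]→ₗ[ℝ] MvPolynomial (Fin m) ℝ) : Form m k :=
  fun x => (aeval (R := ℝ) x).toLinearMap.compAlternatingMap A

lemma evalForm_apply (A : Vec m [⋀^Fin k]→ₗ[ℝ] MvPolynomial (Fin m) ℝ) (x : Vec m)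
    (v : Fin k → Vec m) : evalForm A x v = eval x (A v) := by
  simp [evalForm, aeval_eq_eval]

lemma evalForm_mem_PL {A : Vec m [⋀^Fin k]→ₗ[ℝ] MvPolynomial (Fin m) ℝ} {r : ℤ}
    (hA : ∀ v, degLE r (A v)) : evalForm A ∈ PL m k r :=
  fun v => ⟨A v, hA v, fun x => evalForm_apply A x v⟩

lemma degLE_of_basis {A : Vec m [⋀^Fin k]→ₗ[ℝ] MvPolynomial (Fin m) ℝ} {r : ℤ}
    (hA : ∀ f : Fin k → Fin m, Function.Injective f → degLE r (A fun l => Pi.single (f l) 1))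
    (v : Fin k → Vec m) : degLE r (A v) := by
  rw [alternating_expand A v]
  refine degLE_sum _ _ fun f _ => degLE_smul _ ?_
  by_cases hf : Function.Injective f
  · exact hA f hf
  · rw [alternating_single_eq_zero A hf]
    exact degLE_zero

lemma PL_sub {r : ℤ} {α β : Form m k} (hα : α ∈ PL m k r) (hβ : β ∈ PL m k r) :
    α - β ∈ PL m k r := by
  intro v
  obtain ⟨p, hp, h⟩ := hα v
  obtain ⟨q, hq, h'⟩ := hβ v
  refine ⟨p + (-1 : ℝ) • q, degLE_add hp (degLE_smul _ hq), fun x => ?_⟩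
  simp [h, h', sub_eq_add_neg]

lemma PL_smul {r : ℤ} (c : ℝ) {α : Form m k} (hα : α ∈ PL m k r) : c • α ∈ PL m k r := by
  intro v
  obtain ⟨p, hp, h⟩ := hα v
  exact ⟨c • p, degLE_smul _ hp, fun x => by simp [h, smul_eval]⟩

/-- Projection onto the hyperplane of vectors with vanishing coordinate sum, along the `j`-th
coordinate direction. -/
def projVertex (m : ℕ) (j : Fin m) : Vec m →ₗ[ℝ] Vec m :=
  LinearMap.id - (sumLin m).smulRight (Pi.single j 1)

lemma projVertex_apply (j : Fin m) (v : Vec m) :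
    projVertex m j v = v - (∑ i, v i) • Pi.single j 1 := by
  simp [projVertex, sumLin]

/-- A representative of a form on the simplex adapted to all faces at once: the average
`r⁻¹ Σ_j x_j ∂_j`, over the vertices `j`, of the homogenized form contracted with the tangent
projection at the vertex `j`. -/
def eulerForm (r : ℕ) (A : Vec m [⋀^Fin k]→ₗ[ℝ] MvPolynomial (Fin m) ℝ) :
    Vec m [⋀^Fin k]→ₗ[ℝ] MvPolynomial (Fin m) ℝ :=
  (r : ℝ)⁻¹ • ∑ j, ((monoMap id fun d => (d j : ℝ)) ∘ₗ homog r).compAlternatingMap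
    (A.compLinearMap (projVertex m j))

lemma eulerForm_apply (r : ℕ) (A : Vec m [⋀^Fin k]→ₗ[ℝ] MvPolynomial (Fin m) ℝ)
    (v : Fin k → Vec m) :
    eulerForm r A v = (r : ℝ)⁻¹ • ∑ j, monoMap id (fun d => (d j : ℝ))
      (homog r (A fun l => projVertex m j (v l))) := by
  have h (F : Fin m → Vec m [⋀^Fin k]→ₗ[ℝ] MvPolynomial (Fin m) ℝ) :
      (∑ j, F j) v = ∑ j, F j v :=
    map_sum (AddMonoidHom.mk' (fun g : Vec m [⋀^Fin k]→ₗ[ℝ] MvPolynomial (Fin m) ℝ => g v)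
      fun _ _ => rfl) F _
  rw [eulerForm, AlternatingMap.smul_apply, h]
  rfl

variable {r : ℕ} {A : Vec m [⋀^Fin k]→ₗ[ℝ] MvPolynomial (Fin m) ℝ}

lemma degLE_eulerForm (hA : ∀ v, degLE r (A v)) (v : Fin k → Vec m) :
    degLE r (eulerForm r A v) := by
  rw [eulerForm_apply]
  refine degLE_smul _ (degLE_sum _ _ fun j _ => degLE_monoMap _ _ fun d hd => ?_)
  exact_mod_cast (sum_eq_of_isHomogeneous (homog_isHomogeneous (hA _)) hd).le

lemma eval_eulerForm (hr : 1 ≤ r) (hA : ∀ v, degLE r (A v)) {v : Fin k → Vec m}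
    (hv : ∀ l, ∑ i, v l i = 0) {x : Vec m} (hx : ∑ i, x i = 1) :
    eval x (eulerForm r A v) = eval x (A v) := by
  have h1 : ∀ j, (fun l => projVertex m j (v l)) = v := fun j => by
    funext l
    simp [projVertex_apply, hv]
  have hr' : (r : ℝ) ≠ 0 := by positivity
  rw [eulerForm_apply]
  simp only [h1]
  rw [← eval_homog r (A v) hx, smul_eval, map_sum, eval_eq']
  simp only [eval_monoMap, id]
  rw [Finset.sum_comm, inv_mul_eq_iff_eq_mul₀ hr', Finset.mul_sum]
  refine Finset.sum_congr rfl fun d hd => ?_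
  have h2 : ∑ i, (d i : ℝ) = r := by
    exact_mod_cast sum_eq_of_isHomogeneous (homog_isHomogeneous (hA v)) hd
  rw [← h2, Finset.sum_mul]
  refine Finset.sum_congr rfl fun j _ => ?_
  ring

lemma ne_zero_of_mem_support_eulerForm (hm : 2 ≤ m) (hA : ∀ v, degLE r (A v)) {i : Fin m}
    (h : ∀ x ∈ simplexSet m, x i = 0 → ∀ v : Fin k → Vec m,
      (∀ l, (∑ j, v l j) = 0 ∧ v l i = 0) → eval x (A v) = 0)
    {f : Fin k → Fin m} (hf : ∀ l, f l ≠ i) {d : Fin m →₀ ℕ}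
    (hd : d ∈ (eulerForm r A fun l => Pi.single (f l) 1).support) : d i ≠ 0 := by
  classical
  rw [eulerForm_apply] at hd
  obtain ⟨j, -, hj⟩ := Finset.mem_biUnion.mp (support_sum (support_smul hd))
  obtain ⟨h1, h2⟩ := support_monoMap_id hj
  by_cases hij : i = j
  · subst hij
    exact_mod_cast h1
  · refine ne_zero_of_mem_support_homog (hA _) hm i (fun x hx hxi => h x hx hxi _ fun l => ?_) h2
    simp [projVertex_apply, hij, (hf l).symm]

end PolynomialForms

section Reflections

open MvPolynomial

variable {m k : ℕ}

lemma coe_reflLin (i : Fin m) (v : Vec m) : reflLin m i v = reflFun m i v := by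
  funext j
  by_cases h : j = i <;> simp [reflLin, reflFun, h]

lemma reflFun_reflFun (i : Fin m) (v : Vec m) : reflFun m i (reflFun m i v) = v := by
  funext j
  by_cases h : j = i <;> simp [reflFun, h]

lemma reflFun_comm (i j : Fin m) (v : Vec m) :
    reflFun m i (reflFun m j v) = reflFun m j (reflFun m i v) := by
  funext l
  simp only [reflFun]
  split_ifs <;> rfl

lemma reflPull_apply (i : Fin m) (α : Form m k) (u : Vec m) (v : Fin k → Vec m) :
    reflPull m k i α u v = α (reflFun m i u) fun l => reflFun m i (v l) := by
  simp only [reflPull, AlternatingMap.compLinearMap_apply, coe_reflLin]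

lemma eval_reflFun (i : Fin m) (p : MvPolynomial (Fin m) ℝ) (u : Vec m) :
    eval (reflFun m i u) p = eval u (monoMap id (fun d => (-1) ^ d i) p) := by
  rw [eval_monoMap, eval_eq']
  refine Finset.sum_congr rfl fun d _ => ?_
  congr 1
  have h : (-1 : ℝ) ^ d i = ∏ j, if j = i then (-1) ^ d j else 1 := by simp
  rw [h, ← Finset.prod_mul_distrib]
  refine Finset.prod_congr rfl fun j _ => ?_
  by_cases hj : j = i
  · subst hj; simp [reflFun, ← mul_pow]
  · simp [reflFun, hj]

lemma reflPull_mem_PL {r : ℤ} (i : Fin m) {α : Form m k} (hα : α ∈ PL m k r) :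
    reflPull m k i α ∈ PL m k r := by
  intro v
  obtain ⟨p, hp, h⟩ := hα fun l => reflFun m i (v l)
  exact ⟨monoMap id (fun d => (-1) ^ d i) p, degLE_monoMap _ _ (degLE_iff.1 hp), fun x => by
    rw [reflPull_apply, h, eval_reflFun]⟩

lemma projSph_apply (u v : Vec m) : projSph m u v = v - (∑ i, u i * v i) • u := by
  simp [projSph, dotLin]

lemma reflFun_projSph (i : Fin m) (u v : Vec m) :
    reflFun m i (projSph m u v) = projSph m (reflFun m i u) (reflFun m i v) := by
  have h : ∑ j, reflFun m i u j * reflFun m i v j = ∑ j, u j * v j := by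
    refine Finset.sum_congr rfl fun j _ => ?_
    by_cases hj : j = i <;> simp [reflFun, hj]
  rw [projSph_apply, projSph_apply, h]
  funext j
  by_cases hj : j = i
  · simp [reflFun, hj]; ring
  · simp [reflFun, hj]

lemma resSph_reflPull (i : Fin m) (α : Form m k) :
    resSph m k (reflPull m k i α) = reflPullSph m k i (resSph m k α) := by
  funext u
  ext v
  simp only [resSph, reflPullSph, AlternatingMap.compLinearMap_apply, reflPull_apply, coe_reflLin,
    reflFun_projSph]

lemma exists_isOdd_of_isOddSph {s : ℤ} {β : FormOn m (sphereSet m) k} (hβ : β ∈ PLsph m k s)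
    (hodd : IsOddSph m k β) : ∃ β₀ ∈ PL m k s, resSph m k β₀ = β ∧ IsOdd m k β₀ := by
  suffices H : ∀ S : Finset (Fin m), ∃ β₀ ∈ PL m k s, resSph m k β₀ = β ∧
      ∀ i ∈ S, reflPull m k i β₀ = -β₀ by
    obtain ⟨β₀, h1, h2, h3⟩ := H Finset.univ
    exact ⟨β₀, h1, h2, fun i => h3 i (Finset.mem_univ i)⟩
  intro S
  induction S using Finset.induction_on with
  | empty =>
    obtain ⟨β₀, h1, h2⟩ := hβ
    exact ⟨β₀, h1, h2, by simp⟩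
  | insert i S _ ih =>
    obtain ⟨β₀, h1, h2, h3⟩ := ih
    refine ⟨(1 / 2 : ℝ) • (β₀ - reflPull m k i β₀), PL_smul _ (PL_sub h1 (reflPull_mem_PL i h1)),
      ?_, ?_⟩
    · have h4 : resSph m k (reflPull m k i β₀) = -β := by rw [resSph_reflPull, h2, hodd i]
      funext u
      ext v
      have h5 := DFunLike.congr_fun (congrFun h4 u) v
      have h6 := DFunLike.congr_fun (congrFun h2 u) v
      simp only [resSph, AlternatingMap.compLinearMap_apply, Pi.smul_apply, Pi.sub_apply,
        Pi.neg_apply, AlternatingMap.smul_apply, AlternatingMap.sub_apply,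
        AlternatingMap.neg_apply, smul_eq_mul] at h5 h6 ⊢
      rw [h5, h6]
      ring
    · intro j hj
      funext u
      ext v
      simp only [reflPull_apply, Pi.smul_apply, Pi.sub_apply, Pi.neg_apply,
        AlternatingMap.smul_apply, AlternatingMap.sub_apply, AlternatingMap.neg_apply, smul_eq_mul]
      rcases Finset.mem_insert.1 hj with rfl | hj
      · simp only [reflFun_reflFun]
        ring
      · have h4 : ∀ u v, β₀ (reflFun m j u) (fun l => reflFun m j (v l)) = -β₀ u v := fun u v => by
          have := DFunLike.congr_fun (congrFun (h3 j hj) u) v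
          rwa [reflPull_apply] at this
        simp only [reflFun_comm i j, h4]
        ring

lemma mem_image_iff_even_of_isOdd {B : Vec m [⋀^Fin k]→ₗ[ℝ] MvPolynomial (Fin m) ℝ}
    (hB : IsOdd m k (evalForm B)) {f : Fin k → Fin m} (hf : Function.Injective f)
    {d : Fin m →₀ ℕ} (hd : d ∈ (B fun l => Pi.single (f l) 1).support) (i : Fin m) :
    i ∈ Finset.univ.image f ↔ Even (d i) := by
  set p := B fun l => Pi.single (f l) 1 with hp
  set ε : ℝ := ∏ l, if f l = i then -1 else 1 with hε
  have h1 : (B fun l => reflFun m i (Pi.single (f l) 1)) = ε • p := by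
    have : ∀ l, reflFun m i (Pi.single (f l) 1) =
        (if f l = i then (-1 : ℝ) else 1) • (Pi.single (f l) 1 : Vec m) := by
      intro l
      funext j
      by_cases hj : j = i
      · subst hj
        by_cases hl : f l = j
        · simp [reflFun, hl]
        · simp [reflFun, hl, Ne.symm hl]
      · by_cases hl : f l = i
        · simp [reflFun, hj, hl]
        · simp [reflFun, hj, hl]
    simp only [this]
    exact B.toMultilinearMap.map_smul_univ _ _
  have h2 : ε • monoMap id (fun d => (-1) ^ d i) p = -p := by
    refine MvPolynomial.funext fun u => ?_
    have := DFunLike.congr_fun (congrFun (hB i) u) fun l => Pi.single (f l) 1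
    rw [reflPull_apply, evalForm_apply, h1, Pi.neg_apply, AlternatingMap.neg_apply,
      evalForm_apply, eval_reflFun, map_smul] at this
    rw [this, map_neg]
  have h3 : ε * (-1) ^ d i = -1 := by
    have := congrArg (coeff d) h2
    rw [coeff_smul, coeff_monoMap_id, coeff_neg, smul_eq_mul, ← mul_assoc] at this
    exact mul_right_cancel₀ (mem_support_iff.1 hd) (by rw [this]; ring)
  by_cases hi : i ∈ Finset.univ.image f
  · obtain ⟨l₀, -, rfl⟩ := Finset.mem_image.1 hi
    have h4 : ε = -1 := by
      rw [hε]
      simp [hf.eq_iff]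
    rw [h4, neg_one_mul, neg_inj] at h3
    exact iff_of_true hi ((neg_one_pow_eq_one_iff_even (by norm_num)).1 h3)
  · have h4 : ε = 1 := Finset.prod_eq_one fun l _ =>
      if_neg fun h => hi (Finset.mem_image.2 ⟨l, Finset.mem_univ l, h⟩)
    refine iff_of_false hi fun he => ?_
    rw [h4, he.neg_one_pow] at h3
    norm_num at h3

end Reflections

section Pullback

open MvPolynomial

variable {m k : ℕ}

lemma dPhi_apply (u v : Vec m) (i : Fin m) : dPhi m u v i = 2 * u i * v i := by
  simp [dPhi]

lemma phiPull_single (α : Form m k) (u : Vec m) (f : Fin k → Fin m) :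
    phiPull m k α u (fun l => Pi.single (f l) 1) =
      2 ^ k * (∏ l, u (f l)) * α (Phi m u) fun l => Pi.single (f l) 1 := by
  have h : ∀ l, dPhi m u (Pi.single (f l) 1) = (2 * u (f l)) • (Pi.single (f l) 1 : Vec m) := by
    intro l
    funext j
    rw [dPhi_apply]
    by_cases hj : j = f l
    · subst hj; simp
    · simp [hj]
  simp only [phiPull, AlternatingMap.compLinearMap_apply, h]
  refine ((α (Phi m u)).toMultilinearMap.map_smul_univ _ _).trans ?_
  simp [Finset.prod_mul_distrib]

lemma phiPull_reflPull (α : Form m k) (i : Fin m) :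
    reflPull m k i (phiPull m k α) = phiPull m k α := by
  funext u
  ext v
  have h1 : Phi m (reflFun m i u) = Phi m u := by
    funext j
    by_cases hj : j = i <;> simp [Phi, reflFun, hj]
  have h2 : ∀ w, dPhi m (reflFun m i u) (reflFun m i w) = dPhi m u w := by
    intro w
    funext j
    by_cases hj : j = i <;> simp [dPhi_apply, reflFun, hj]
  simp only [reflPull_apply, phiPull, AlternatingMap.compLinearMap_apply, h1, h2]

lemma bubble_reflFun (i : Fin m) (u : Vec m) : bubble m (reflFun m i u) = -bubble m u := by
  have h : ∀ j, reflFun m i u j = (if j = i then -1 else 1) * u j := by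
    intro j
    by_cases hj : j = i <;> simp [reflFun, hj]
  simp only [bubble, h, Finset.prod_mul_distrib]
  simp

lemma prod_X_ne_zero : (∏ i : Fin m, X i : MvPolynomial (Fin m) ℝ) ≠ 0 :=
  Finset.prod_ne_zero_iff.2 fun i _ => X_ne_zero i

lemma eval_prod_X (u : Vec m) : eval u (∏ i : Fin m, X i : MvPolynomial (Fin m) ℝ) = bubble m u := by
  simp [bubble, map_prod]

lemma isOdd_of_phiPull_eq_bubble {α : Form m k} {s : ℤ} {β : Form m k} (hβ : β ∈ PL m k s)
    (h : phiPull m k α = bubbleSmulAmb m k β) : IsOdd m k β := by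
  intro i
  funext u
  ext v
  obtain ⟨p, -, hp⟩ := hβ v
  obtain ⟨q, -, hq⟩ := reflPull_mem_PL i hβ v
  have key : q + p = 0 := by
    refine mul_left_cancel₀ prod_X_ne_zero (MvPolynomial.funext fun u => ?_)
    have h1 := DFunLike.congr_fun (congrFun (phiPull_reflPull α i) u) v
    rw [h, reflPull_apply] at h1
    simp only [bubbleSmulAmb, AlternatingMap.smul_apply, smul_eq_mul, bubble_reflFun] at h1
    rw [← reflPull_apply, hp, hq] at h1
    rw [map_mul, eval_prod_X, map_add, mul_zero, map_zero]
    linarith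
  have := congrArg (eval u) key
  rw [map_add, map_zero] at this
  rw [Pi.neg_apply, AlternatingMap.neg_apply, hp, hq]
  linarith

lemma exists_phiPull_eq_bubble {r s : ℤ} {A : Vec m [⋀^Fin k]→ₗ[ℝ] MvPolynomial (Fin m) ℝ}
    (hA : ∀ v, degLE r (A v))
    (hdiv : ∀ f : Fin k → Fin m, ∀ i, (∀ l, f l ≠ i) →
      ∀ d ∈ (A fun l => Pi.single (f l) 1).support, d i ≠ 0) (hs : 2 * r + k - m ≤ s) :
    ∃ β ∈ PL m k s, phiPull m k (evalForm A) = bubbleSmulAmb m k β := by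
  have hbasis : ∀ f : Fin k → Fin m, ∃ q, degLE s q ∧ ∀ u,
      phiPull m k (evalForm A) u (fun l => Pi.single (f l) 1) = bubble m u * eval u q := by
    intro f
    by_cases hf : Function.Injective f
    · obtain ⟨q, hq, h⟩ := exists_quotient_bubble (S := Finset.univ.image f) (s := s)
        (fun d hd i hi => hdiv f i (fun l hl => hi (Finset.mem_image.2 ⟨l, Finset.mem_univ l, hl⟩))
          d hd) (hA _) (by rw [Finset.card_image_of_injective _ hf]; simpa using hs)
      refine ⟨(2 : ℝ) ^ k • q, degLE_smul _ hq, fun u => ?_⟩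
      have h1 := h u
      rw [Finset.prod_image hf.injOn] at h1
      rw [phiPull_single, evalForm_apply, smul_eval]
      linear_combination 2 ^ k * h1
    · refine ⟨0, degLE_zero, fun u => ?_⟩
      rw [alternating_single_eq_zero _ hf, map_zero, mul_zero]
  choose q hq hq' using hbasis
  obtain ⟨B, hB, h⟩ := exists_polyForm_mul (prod_X_ne_zero (m := m)) (s := s)
    (γ := phiPull m k (evalForm A)) fun v =>
      ⟨∑ f : Fin k → Fin m, (∏ l, v l (f l)) • q f,
        degLE_sum _ _ fun f _ => degLE_smul _ (hq f), fun u => by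
          rw [alternating_expand, map_sum, Finset.mul_sum]
          refine Finset.sum_congr rfl fun f _ => ?_
          rw [hq', smul_eval, eval_prod_X, smul_eq_mul]
          ring⟩
  refine ⟨evalForm B, evalForm_mem_PL hB, ?_⟩
  funext u
  ext v
  rw [h, eval_prod_X]
  simp [bubbleSmulAmb, evalForm_apply]

lemma projSim_eq_self {v : Vec m} (hv : ∑ i, v i = 0) : projSim m v = v := by
  simp [projSim, sumLin, hv]

lemma sum_projSim (hm : m ≠ 0) (v : Vec m) : ∑ i, projSim m v i = 0 := by
  have : (m : ℝ) ≠ 0 := Nat.cast_ne_zero.2 hm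
  simp [projSim, sumLin, this]

lemma sum_dPhi_projSph {u : Vec m} (hu : u ∈ sphereSet m) (v : Vec m) :
    ∑ i, dPhi m u (projSph m u v) i = 0 := by
  have h : ∀ i, dPhi m u (projSph m u v) i =
      2 * (u i * v i) - 2 * (∑ j, u j * v j) * u i ^ 2 := fun i => by
    rw [dPhi_apply, projSph_apply, Pi.sub_apply, Pi.smul_apply, smul_eq_mul]
    ring
  have hu' : ∑ i, u i ^ 2 = 1 := hu
  simp only [h, Finset.sum_sub_distrib, ← Finset.mul_sum, hu']
  ring

lemma phiPullTS_resSim (α : Form m k) :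
    phiPullTS m k (resSim m k α) = resSph m k (phiPull m k α) := by
  funext u
  ext v
  simp only [phiPullTS, resSim, resSph, phiPull, AlternatingMap.compLinearMap_apply,
    LinearMap.comp_apply, projSim_eq_self (sum_dPhi_projSph u.2 _)]

lemma exists_phiPull_of_isOdd {r s : ℤ} {β : Form m k} (hβ : β ∈ PL m k s) (hodd : IsOdd m k β)
    (hs : s + m - k ≤ 2 * r + 1) :
    ∃ α ∈ PL m k r, phiPull m k α = bubbleSmulAmb m k β ∧ vanishBdry m k (resSim m k α) := by
  obtain ⟨B, hB, hβB⟩ := exists_polyForm hβ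
  obtain rfl : β = evalForm B := by
    funext x
    ext v
    rw [hβB, evalForm_apply]
  have hpar := fun (f : Fin k → Fin m) (hf : Function.Injective f) d hd i =>
    mem_image_iff_even_of_isOdd hodd hf (d := d) hd i
  set A : Vec m [⋀^Fin k]→ₗ[ℝ] MvPolynomial (Fin m) ℝ :=
    ((2 : ℝ) ^ k)⁻¹ • halfMap.compAlternatingMap B with hA
  have hAv : ∀ v, A v = ((2 : ℝ) ^ k)⁻¹ • halfMap (B v) := fun v => rfl
  refine ⟨evalForm A, evalForm_mem_PL (degLE_of_basis fun f hf => ?_), ?_, ?_⟩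
  · refine degLE_smul _ (degLE_halfMap (hpar f hf) (hB _) ?_)
    rw [Finset.card_image_of_injective _ hf]
    simpa using hs
  · funext u
    refine alternating_ext fun f hf => ?_
    have h1 := eval_halfMap (hpar f hf) u
    rw [Finset.prod_image hf.injOn] at h1
    rw [phiPull_single, evalForm_apply, hAv, smul_eval, bubbleSmulAmb, AlternatingMap.smul_apply,
      evalForm_apply, smul_eq_mul, ← h1]
    field_simp
  · intro x i hxi v hv
    have h1 : (fun l => projSim m (v l)) = v := funext fun l => projSim_eq_self (hv l).1
    rw [resSim, AlternatingMap.compLinearMap_apply, h1, alternating_expand]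
    refine Finset.sum_eq_zero fun f _ => ?_
    by_cases hf : Function.Injective f
    · by_cases hi : i ∈ Finset.univ.image f
      · obtain ⟨l, -, hl⟩ := Finset.mem_image.1 hi
        rw [Finset.prod_eq_zero (Finset.mem_univ l) (by rw [hl, (hv l).2]), zero_smul]
      · rw [evalForm_apply, hAv, smul_eval, eval_halfMap_eq_zero (hpar f hf) hi hxi, mul_zero,
          smul_zero]
    · rw [alternating_single_eq_zero _ hf, smul_zero]

lemma resSph_bubbleSmulAmb (β : Form m k) :
    resSph m k (bubbleSmulAmb m k β) = bubbleSmul m k (resSph m k β) := rfl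

lemma phiPullTS_mem {r : ℕ} {s : ℤ} (hm : 2 ≤ m) (hr : 1 ≤ r) (hs : 2 * (r : ℤ) + k - m ≤ s)
    {a : FormOn m (simplexSet m) k} (ha : a ∈ PLosim m k r) :
    ∃ β ∈ PLsph m k s, IsOddSph m k β ∧ bubbleSmul m k β = phiPullTS m k a := by
  obtain ⟨⟨α, hα, rfl⟩, hbd⟩ := ha
  obtain ⟨A, hA, hαA⟩ := exists_polyForm hα
  have hE := fun v => degLE_eulerForm hA v
  obtain ⟨β, hβ, hαβ⟩ := exists_phiPull_eq_bubble (s := s) hE (fun f i hf d hd =>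
    ne_zero_of_mem_support_eulerForm hm hA (fun x hx hxi v hv => by
      have h1 := hbd ⟨x, hx⟩ i hxi v hv
      have h2 : (fun l => projSim m (v l)) = v := funext fun l => projSim_eq_self (hv l).1
      rwa [resSim, AlternatingMap.compLinearMap_apply, h2, hαA] at h1) hf hd) hs
  refine ⟨resSph m k β, ⟨β, hβ, rfl⟩, fun i => ?_, ?_⟩
  · rw [← resSph_reflPull, isOdd_of_phiPull_eq_bubble hβ hαβ i]
    rfl
  · rw [← resSph_bubbleSmulAmb, ← hαβ, ← phiPullTS_resSim]
    congr 1
    funext x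
    ext v
    simp only [resSim, AlternatingMap.compLinearMap_apply]
    rw [evalForm_apply, hαA, eval_eulerForm hr hA (fun l => sum_projSim (by omega) _) x.2.2]

lemma phiPullTS_injOn (hm : m ≠ 0) (r : ℕ) :
    Set.InjOn (phiPullTS m k) (PLsim m k r) := by
  rintro _ ⟨α, hα, rfl⟩ _ ⟨α', hα', rfl⟩ h
  funext x
  ext v
  obtain ⟨p, hp, hpe⟩ := PL_sub hα hα' fun l => projSim m (v l)
  simp only [resSim, AlternatingMap.compLinearMap_apply]
  rw [← sub_eq_zero]
  refine (hpe x).trans (eval_eq_zero_of_interior hp (fun y hy hy1 => ?_) x.2.2)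
  rw [← hpe]
  set u : Vec m := fun i => Real.sqrt (y i) with hu
  have hu0 : ∀ i, u i ≠ 0 := fun i => (Real.sqrt_pos.2 (hy i)).ne'
  have hΦ : Phi m u = y := funext fun i => Real.sq_sqrt (hy i).le
  have huS : u ∈ sphereSet m := by
    have : ∑ i, Phi m u i = 1 := by rw [hΦ, hy1]
    exact this
  have hw : ∀ l, dPhi m u (projSph m u fun i => projSim m (v l) i / (2 * u i)) =
      projSim m (v l) := by
    intro l
    have h1 : ∑ i, u i * (projSim m (v l) i / (2 * u i)) = 0 := by
      have : ∀ i, u i * (projSim m (v l) i / (2 * u i)) = projSim m (v l) i / 2 := fun i => by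
        field_simp [hu0 i]
      simp only [this, ← Finset.sum_div, sum_projSim hm, zero_div]
    rw [projSph_apply, h1, zero_smul, sub_zero]
    funext i
    rw [dPhi_apply]
    field_simp [hu0 i]
  have h2 := DFunLike.congr_fun (congrFun h ⟨u, huS⟩)
    fun l i => projSim m (v l) i / (2 * u i)
  rw [phiPullTS_resSim, phiPullTS_resSim] at h2
  simp only [resSph, phiPull, AlternatingMap.compLinearMap_apply, hw, hΦ] at h2
  rw [Pi.sub_apply, AlternatingMap.sub_apply, h2, sub_self]

end Pullback

theorem stmt2 (n k r : ℕ) (hn : 1 ≤ n) (hk : k ≤ n) (hr : 1 ≤ r) :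
    Set.BijOn (phiPullTS (n + 1) k) (PLosim (n + 1) k (r : ℤ))
      (bubbleSmul (n + 1) k ''
        {β ∈ PLsph (n + 1) k (2 * (r : ℤ) + k - n - 1) | IsOddSph (n + 1) k β}) ∧
    (∀ a b, phiPullTS (n + 1) k (a + b) = phiPullTS (n + 1) k a + phiPullTS (n + 1) k b) ∧
    (∀ (c : ℝ) a, phiPullTS (n + 1) k (c • a) = c • phiPullTS (n + 1) k a) := by
  refine ⟨⟨fun a ha => ?_, (phiPullTS_injOn n.succ_ne_zero r).mono fun a ha => ha.1, ?_⟩,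
    fun _ _ => rfl, fun _ _ => rfl⟩
  · obtain ⟨β, hβ, hodd, h⟩ := phiPullTS_mem (s := 2 * (r : ℤ) + k - n - 1) (by omega) hr
      (by push_cast; omega) ha
    exact ⟨β, ⟨hβ, hodd⟩, h⟩
  · rintro _ ⟨β, ⟨hβ, hodd⟩, rfl⟩
    obtain ⟨β₀, hβ₀, rfl, hodd₀⟩ := exists_isOdd_of_isOddSph hβ hodd
    obtain ⟨α, hα, hαβ, hbd⟩ := exists_phiPull_of_isOdd (r := r) hβ₀ hodd₀ (by push_cast; omega)
    exact ⟨resSim _ _ α, ⟨⟨α, hα, rfl⟩, hbd⟩, by rw [phiPullTS_resSim, hαβ, resSph_bubbleSmulAmb]⟩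

end
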